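/- Let k ≥ 1 be an integer and let f : (0,∞) → ℂ be continuous with compact support in (0,∞). Then ψ(r) := ∫₀^∞ G_k(r,ρ) f(ρ) dρ defines a C² function on (0,∞) that satisfies ψ''(r) + ψ'(r)/r − k² ψ(r)/r² = −f(r) for every r > 0, and there is a constant C (depending on k and f) with |ψ(r)| ≤ C r^k for r ≤ 1 and |ψ(r)| ≤ C r^{−k} for r ≥ 1. -/

import Mathlib

open MeasureTheory

noncomputable section

/-- The Japanese bracket `⟨x⟩ = √(x²+2)`. -/
def jap (x : ℝ) : ℝ := Real.sqrt (x ^ 2 + 2)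

/-- The operator `f ↦ r ∂_r f`. -/
def rDer {E : Type*} [NormedAddCommGroup E] [NormedSpace ℝ E] (f : ℝ → E) : ℝ → E :=
  fun r => r • deriv f r

/-- Iterates of the operator `r ∂_r`. -/
def rDerIter {E : Type*} [NormedAddCommGroup E] [NormedSpace ℝ E] : ℕ → (ℝ → E) → ℝ → E
  | 0, f => f
  | n + 1, f => rDer (rDerIter n f)

/-- The background vortex assumption on `Ω`, with constants `Cs = C_* > 0`, `cs = c_* < 0`:
`Ω` is smooth on `(0,∞)`, `0 < Ω(r) ≤ C_*⟨r⟩⁻⁶`, `Ω'(r) < 0`, and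
`|(r d/dr)^j (Ω'(r)/r − c_*⟨r⟩⁻⁸)| ≤ C_*^{j+1} (j!)² r² ⟨r⟩⁻¹⁰`. -/
def VortexAssumption (Ω : ℝ → ℝ) (Cs cs : ℝ) : Prop :=
  ContDiffOn ℝ (⊤ : ℕ∞) Ω (Set.Ioi 0) ∧ 0 < Cs ∧ cs < 0 ∧
    (∀ r : ℝ, 0 < r → 0 < Ω r ∧ Ω r ≤ Cs / jap r ^ 6 ∧ deriv Ω r < 0) ∧
    (∀ (j : ℕ) (r : ℝ), 0 < r →
      |rDerIter j (fun s => deriv Ω s / s - cs / jap s ^ 8) r| ≤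
        Cs ^ (j + 1) * (j.factorial : ℝ) ^ 2 * r ^ 2 / jap r ^ 10)

/-- `b(r) = ∫₀¹ s Ω(rs) ds`. -/
def bfun (Ω : ℝ → ℝ) (r : ℝ) : ℝ := ∫ s in (0:ℝ)..1, s * Ω (r * s)

/-- `d(r) = Ω'(r)/r`. -/
def dfun (Ω : ℝ → ℝ) (r : ℝ) : ℝ := deriv Ω r / r

/-- `B(v) = b(eᵛ)`. -/
def Bv (Ω : ℝ → ℝ) (v : ℝ) : ℝ := bfun Ω (Real.exp v)

/-- `D(v) = d(eᵛ)`. -/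
def Dv (Ω : ℝ → ℝ) (v : ℝ) : ℝ := dfun Ω (Real.exp v)

/-- The Green's function `G_k(r,ρ)`. -/
def Gk (k : ℕ) (r ρ : ℝ) : ℝ :=
  if r < ρ then ρ / (2 * k) * (r / ρ) ^ k else ρ / (2 * k) * (ρ / r) ^ k

/-- The measure `r dr` on `(0,∞)`. -/
def muX : Measure ℝ := (volume.restrict (Set.Ioi 0)).withDensity fun r => ENNReal.ofReal r

/-- The space `X = L²((0,∞), r dr; ℂ)`. -/
abbrev X : Type := Lp ℂ 2 muX

/-- `ℓ(v,w)`: the length of the interval `[min v w, max v w] ∩ [min w 0, 0]`. -/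
def ell (v w : ℝ) : ℝ :=
  (volume (Set.Icc (min v w) (max v w) ∩ Set.Icc (min w 0) 0)).toReal

end

/-- The derivative of `∫_{-∞}^r p` for a continuous integrable `p`. -/
theorem hasDerivAt_integral_Iic {p : ℝ → ℂ} (hp : Continuous p) (hpi : Integrable p) (r : ℝ) :
    HasDerivAt (fun r => ∫ ρ in Set.Iic r, p ρ) (p r) r := by
  have h : (fun r => ∫ ρ in Set.Iic r, p ρ) =
      fun r => (∫ ρ in Set.Iic (0 : ℝ), p ρ) + ∫ ρ in (0 : ℝ)..r, p ρ := by
    funext r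
    rw [← intervalIntegral.integral_Iic_sub_Iic hpi.integrableOn hpi.integrableOn]
    ring
  rw [h]
  exact (hp.integral_hasStrictDerivAt 0 r).hasDerivAt.const_add _

/-- The derivative of `∫_r^∞ q` for a continuous integrable `q`. -/
theorem hasDerivAt_integral_Ioi {q : ℝ → ℂ} (hq : Continuous q) (hqi : Integrable q) (r : ℝ) :
    HasDerivAt (fun r => ∫ ρ in Set.Ioi r, q ρ) (-q r) r := by
  have h : (fun r => ∫ ρ in Set.Ioi r, q ρ) = fun r => (∫ ρ, q ρ) - ∫ ρ in Set.Iic r, q ρ := by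
    funext r
    rw [← intervalIntegral.integral_Iic_add_Ioi (b := r) hqi.integrableOn hqi.integrableOn]
    ring
  rw [h]
  exact (hasDerivAt_integral_Iic hq hqi r).const_sub _

theorem norm_setIntegral_le_integral_norm {p : ℝ → ℂ} (hpi : Integrable p) (s : Set ℝ) :
    ‖∫ ρ in s, p ρ‖ ≤ ∫ ρ, ‖p ρ‖ :=
  (norm_integral_le_integral_norm _).trans
    (setIntegral_le_integral hpi.norm (Filter.Eventually.of_forall fun _ => norm_nonneg _))

/-- The derivative of `r ^ k`, written without lowering the exponent. -/
theorem hasDerivAt_ofReal_pow (k : ℕ) {r : ℝ} (hr : r ≠ 0) :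
    HasDerivAt (fun r : ℝ => (r : ℂ) ^ k) (k * (r : ℂ) ^ k / r) r := by
  have h := (Complex.ofRealCLM.hasDerivAt (x := r)).pow k
  have hr' : (r : ℂ) ≠ 0 := Complex.ofReal_ne_zero.mpr hr
  refine h.congr_deriv ?_
  rcases k with _ | k
  · simp
  · simp [pow_succ]
    field_simp

theorem hasDerivAt_ofReal_pow_inv (k : ℕ) {r : ℝ} (hr : r ≠ 0) :
    HasDerivAt (fun r : ℝ => ((r : ℂ) ^ k)⁻¹) (-(k * ((r : ℂ) ^ k)⁻¹ / r)) r := by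
  have hr' : (r : ℂ) ≠ 0 := Complex.ofReal_ne_zero.mpr hr
  refine ((hasDerivAt_ofReal_pow k hr).inv (pow_ne_zero k hr')).congr_deriv ?_
  field_simp

/-- A function compactly supported in `(0,∞)` lives on some `[a,b]` with `a > 0`. -/
theorem exists_pos_bounds_of_hasCompactSupport {f : ℝ → ℂ} (hfsupp : HasCompactSupport f)
    (hfpos : tsupport f ⊆ Set.Ioi 0) :
    ∃ a b : ℝ, 0 < a ∧ 0 < b ∧ (∀ ρ < a, f ρ = 0) ∧ ∀ ρ, b < ρ → f ρ = 0 := by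
  have hK : IsCompact (insert 1 (tsupport f)) := hfsupp.isCompact.insert 1
  have hpos : insert 1 (tsupport f) ⊆ Set.Ioi (0 : ℝ) := Set.insert_subset (by simp) hfpos
  obtain ⟨a, ha, hla⟩ := hK.exists_isLeast ⟨1, by simp⟩
  obtain ⟨b, hb, hub⟩ := hK.exists_isGreatest ⟨1, by simp⟩
  refine ⟨a, b, hpos ha, hpos hb, fun ρ hρ => ?_, fun ρ hρ => ?_⟩
  · by_contra h
    exact hρ.not_ge (hla (Set.mem_insert_of_mem _ (subset_tsupport f h)))
  · by_contra h
    exact hρ.not_ge (hub (Set.mem_insert_of_mem _ (subset_tsupport f h)))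

/-- If `S` and `T` solve `S' = -kS/r + r f` and `T' = kT/r - r f` on `(0,∞)`, then
`ψ = (S + T)/(2k)` is `C²` and solves `ψ'' + ψ'/r - k²ψ/r² = -f` there. -/
theorem contDiffOn_and_ode_of_first_order_system {k : ℕ} (hk : k ≠ 0) {f S T ψ : ℝ → ℂ}
    (hf : Continuous f)
    (hS : ∀ r : ℝ, 0 < r → HasDerivAt S (-(k * S r / r) + r * f r) r)
    (hT : ∀ r : ℝ, 0 < r → HasDerivAt T (k * T r / r - r * f r) r)
    (hψ : ∀ r : ℝ, 0 < r → ψ r = (S r + T r) / (2 * k)) :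
    ContDiffOn ℝ 2 ψ (Set.Ioi 0) ∧
    ∀ r : ℝ, 0 < r →
      deriv (deriv ψ) r + deriv ψ r / (r : ℂ) - (k : ℂ) ^ 2 * ψ r / (r : ℂ) ^ 2 = -f r := by
  have hk' : (k : ℂ) ≠ 0 := Nat.cast_ne_zero.mpr hk
  have hne : ∀ r : ℝ, 0 < r → (r : ℂ) ≠ 0 := fun r hr => Complex.ofReal_ne_zero.mpr hr.ne'
  have hd1 : ∀ r : ℝ, 0 < r → HasDerivAt ψ ((T r - S r) / (2 * r)) r := fun r hr => by
    have h := ((hS r hr).add (hT r hr)).div_const (2 * (k : ℂ))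
    refine (h.congr_of_eventuallyEq ?_).congr_deriv ?_
    · filter_upwards [Ioi_mem_nhds hr] with x hx using hψ x hx
    · have := hne r hr
      field_simp
      ring
  have hd2 : ∀ r : ℝ, 0 < r → HasDerivAt (deriv ψ)
      ((k * (S r + T r) / r - 2 * (r * f r)) / (2 * r) - (T r - S r) / (2 * r ^ 2)) r :=
    fun r hr => by
      have hr' := hne r hr
      have hden : HasDerivAt (fun r : ℝ => 2 * (r : ℂ)) 2 r := by
        simpa using (Complex.ofRealCLM.hasDerivAt (x := r)).const_mul (2 : ℂ)
      have h := ((hT r hr).sub (hS r hr)).div hden (by simpa using hr')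
      refine (h.congr_of_eventuallyEq ?_).congr_deriv ?_
      · filter_upwards [Ioi_mem_nhds hr] with x hx using (hd1 x hx).deriv
      · simp only [Pi.sub_apply]
        field_simp
        ring
  refine ⟨?_, fun r hr => ?_⟩
  · have hSc : ContinuousOn S (Set.Ioi 0) := fun r hr => (hS r hr).continuousAt.continuousWithinAt
    have hTc : ContinuousOn T (Set.Ioi 0) := fun r hr => (hT r hr).continuousAt.continuousWithinAt
    have hid : ContinuousOn (fun r : ℝ => (r : ℂ)) (Set.Ioi 0) :=
      Complex.continuous_ofReal.continuousOn
    have hfc : ContinuousOn f (Set.Ioi 0) := hf.continuousOn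
    rw [show (2 : WithTop ℕ∞) = 1 + 1 by norm_num, contDiffOn_succ_iff_deriv_of_isOpen isOpen_Ioi]
    refine ⟨fun r hr => (hd1 r hr).differentiableAt.differentiableWithinAt, by simp, ?_⟩
    rw [show (1 : WithTop ℕ∞) = 0 + 1 by norm_num, contDiffOn_succ_iff_deriv_of_isOpen isOpen_Ioi,
      contDiffOn_zero]
    refine ⟨fun r hr => (hd2 r hr).differentiableAt.differentiableWithinAt, by simp, ?_⟩
    refine ContinuousOn.congr ?_ fun r hr => (hd2 r hr).deriv
    refine ContinuousOn.sub (ContinuousOn.div (ContinuousOn.sub (ContinuousOn.div ?_ hid hne) ?_)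
      ?_ ?_) (ContinuousOn.div ?_ ?_ ?_)
    any_goals fun_prop
    · intro r hr
      simpa using hne r hr
    · intro r hr
      simpa using hne r hr
  · rw [(hd2 r hr).deriv, (hd1 r hr).deriv, hψ r hr]
    have := hne r hr
    field_simp
    ring

/-- The Green's function `G_k` inverts the modified Bessel-type operator: for continuous
`f` compactly supported in `(0,∞)`, `ψ = ∫ G_k(·,ρ) f(ρ) dρ` is `C²` on `(0,∞)`, satisfies
`ψ'' + ψ'/r - k²ψ/r² = -f`, and has the natural growth bounds at `0` and `∞`. -/
theorem green_function_inverts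
    (k : ℕ) (hk : 1 ≤ k)
    (f : ℝ → ℂ) (hf : Continuous f) (hfsupp : HasCompactSupport f)
    (hfpos : tsupport f ⊆ Set.Ioi 0)
    (ψ : ℝ → ℂ) (hψ : ∀ r : ℝ, ψ r = ∫ ρ in Set.Ioi (0:ℝ), (Gk k r ρ : ℂ) * f ρ) :
    ContDiffOn ℝ 2 ψ (Set.Ioi 0) ∧
    (∀ r : ℝ, 0 < r →
      deriv (deriv ψ) r + deriv ψ r / (r : ℂ) - (k : ℂ) ^ 2 * ψ r / (r : ℂ) ^ 2 = -f r) ∧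
    ∃ C : ℝ, 0 < C ∧
      (∀ r : ℝ, 0 < r → r ≤ 1 → ‖ψ r‖ ≤ C * r ^ k) ∧
      (∀ r : ℝ, 1 ≤ r → ‖ψ r‖ ≤ C * r ^ (-(k : ℝ))) := by
  obtain ⟨a, b, ha, hb, hfa, hfb⟩ := exists_pos_bounds_of_hasCompactSupport hfsupp hfpos
  have hk0 : k ≠ 0 := by omega
  set p : ℝ → ℂ := fun ρ => (ρ : ℂ) ^ (k + 1) * f ρ with hp_def
  -- `max ρ a` agrees with `ρ` on the support of `f` and makes the continuity of `q` evident.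
  set q : ℝ → ℂ := fun ρ => (ρ : ℂ) * (((max ρ a : ℝ) : ℂ) ^ k)⁻¹ * f ρ with hq_def
  have hp : Continuous p := by fun_prop
  have hq : Continuous q := by
    have h : ∀ ρ : ℝ, ((max ρ a : ℝ) : ℂ) ^ k ≠ 0 := fun ρ =>
      pow_ne_zero _ (Complex.ofReal_ne_zero.mpr (ha.trans_le (le_max_right ρ a)).ne')
    have h' : Continuous fun ρ : ℝ => (((max ρ a : ℝ) : ℂ) ^ k)⁻¹ :=
      Continuous.inv₀ (by fun_prop) h
    fun_prop
  have hpi : Integrable p := hp.integrable_of_hasCompactSupport hfsupp.mul_left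
  have hqi : Integrable q := hq.integrable_of_hasCompactSupport hfsupp.mul_left
  have hqf : ∀ ρ, q ρ = (ρ : ℂ) * ((ρ : ℂ) ^ k)⁻¹ * f ρ := fun ρ => by
    rcases lt_or_ge ρ a with h | h
    · simp [hq_def, hfa ρ h]
    · simp only [hq_def, max_eq_left h]
  set S : ℝ → ℂ := fun r => ((r : ℂ) ^ k)⁻¹ * ∫ ρ in Set.Iic r, p ρ with hS_def
  set T : ℝ → ℂ := fun r => (r : ℂ) ^ k * ∫ ρ in Set.Ioi r, q ρ with hT_def
  have hS : ∀ r : ℝ, 0 < r → HasDerivAt S (-(k * S r / r) + r * f r) r := fun r hr => by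
    have hr' : (r : ℂ) ≠ 0 := Complex.ofReal_ne_zero.mpr hr.ne'
    refine ((hasDerivAt_ofReal_pow_inv k hr.ne').mul
      (hasDerivAt_integral_Iic hp hpi r)).congr_deriv ?_
    simp only [hS_def, hp_def, pow_succ]
    field_simp
  have hT : ∀ r : ℝ, 0 < r → HasDerivAt T (k * T r / r - r * f r) r := fun r hr => by
    have hr' : (r : ℂ) ≠ 0 := Complex.ofReal_ne_zero.mpr hr.ne'
    refine ((hasDerivAt_ofReal_pow k hr.ne').mul
      (hasDerivAt_integral_Ioi hq hqi r)).congr_deriv ?_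
    rw [hqf r]
    simp only [hT_def]
    field_simp
    ring
  have hψST : ∀ r : ℝ, 0 < r → ψ r = (S r + T r) / (2 * k) := fun r hr => by
    have hr' : (r : ℂ) ≠ 0 := Complex.ofReal_ne_zero.mpr hr.ne'
    have hpt : ∀ ρ, (Gk k r ρ : ℂ) * f ρ =
        (((r : ℂ) ^ k)⁻¹ * (Set.Iic r).indicator p ρ +
          (r : ℂ) ^ k * (Set.Ioi r).indicator q ρ) / (2 * k) := fun ρ => by
      rcases lt_or_ge r ρ with h | h
      · have hρ : (ρ : ℂ) ≠ 0 := Complex.ofReal_ne_zero.mpr (hr.trans h).ne'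
        rw [Set.indicator_of_notMem (by simpa using h), Set.indicator_of_mem (by simpa using h),
          hqf ρ, Gk, if_pos h]
        push_cast [div_pow]
        field_simp
        ring
      · rw [Set.indicator_of_mem (by simpa using h), Set.indicator_of_notMem (by simpa using h),
          Gk, if_neg h.not_gt]
        simp only [hp_def]
        push_cast [div_pow]
        field_simp
        ring
    rw [hψ r, setIntegral_eq_integral_of_forall_compl_eq_zero fun ρ hρ => by
      rw [hfa ρ ((not_lt.mp hρ).trans_lt ha), mul_zero]]
    simp_rw [hpt]
    rw [integral_div, integral_add ((hpi.indicator measurableSet_Iic).const_mul _)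
      ((hqi.indicator measurableSet_Ioi).const_mul _), integral_const_mul, integral_const_mul,
      integral_indicator measurableSet_Iic, integral_indicator measurableSet_Ioi]
  obtain ⟨hC2, hode⟩ := contDiffOn_and_ode_of_first_order_system hk0 hf hS hT hψST
  refine ⟨hC2, hode, ?_⟩
  set M : ℝ := ∫ ρ, ‖p ρ‖
  set N : ℝ := ∫ ρ, ‖q ρ‖
  have hM : 0 ≤ M := integral_nonneg fun _ => norm_nonneg _
  have hN : 0 ≤ N := integral_nonneg fun _ => norm_nonneg _
  have hSinf : ∀ r : ℝ, 0 < r → ‖S r‖ ≤ M * (r ^ k)⁻¹ := fun r hr => by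
    simp only [hS_def, norm_mul, norm_inv, norm_pow, Complex.norm_real, Real.norm_of_nonneg hr.le]
    rw [mul_comm]
    gcongr
    exact norm_setIntegral_le_integral_norm hpi _
  have hTzero : ∀ r : ℝ, 0 < r → ‖T r‖ ≤ N * r ^ k := fun r hr => by
    simp only [hT_def, norm_mul, norm_pow, Complex.norm_real, Real.norm_of_nonneg hr.le]
    rw [mul_comm]
    gcongr
    exact norm_setIntegral_le_integral_norm hqi _
  have hSzero : ∀ r : ℝ, 0 < r → ‖S r‖ ≤ M * ((a ^ k) ^ 2)⁻¹ * r ^ k := fun r hr => by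
    rcases lt_or_ge r a with h | h
    · have : ∫ ρ in Set.Iic r, p ρ = 0 := setIntegral_eq_zero_of_forall_eq_zero fun ρ hρ => by
        simp [hp_def, hfa ρ (lt_of_le_of_lt hρ h)]
      simp only [hS_def, this, mul_zero, norm_zero]
      positivity
    · refine (hSinf r hr).trans ?_
      rw [mul_assoc]
      gcongr
      rw [inv_mul_eq_div, inv_le_iff_one_le_mul₀ (by positivity), div_mul_eq_mul_div, ← sq,
        one_le_div (by positivity)]
      gcongr
  have hTinf : ∀ r : ℝ, 0 < r → ‖T r‖ ≤ N * (b ^ k) ^ 2 * (r ^ k)⁻¹ := fun r hr => by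
    rcases lt_or_ge b r with h | h
    · have : ∫ ρ in Set.Ioi r, q ρ = 0 := setIntegral_eq_zero_of_forall_eq_zero fun ρ hρ => by
        simp [hq_def, hfb ρ (h.trans hρ)]
      simp only [hT_def, this, mul_zero, norm_zero]
      positivity
    · refine (hTzero r hr).trans ?_
      rw [mul_assoc]
      gcongr
      rw [← div_eq_mul_inv, le_div_iff₀ (by positivity), ← sq]
      gcongr
  have hψle : ∀ r : ℝ, 0 < r → ‖ψ r‖ ≤ ‖S r‖ + ‖T r‖ := fun r hr => by
    rw [hψST r hr, norm_div]
    have h2k : (1 : ℝ) ≤ ‖(2 * k : ℂ)‖ := by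
      rw [norm_mul, Complex.norm_natCast, Complex.norm_ofNat]
      have : (1 : ℝ) ≤ k := by exact_mod_cast hk
      linarith
    exact (div_le_self (norm_nonneg _) h2k).trans (norm_add_le _ _)
  have hA : 0 ≤ M * ((a ^ k) ^ 2)⁻¹ := by positivity
  have hB : 0 ≤ N * (b ^ k) ^ 2 := by positivity
  refine ⟨M * ((a ^ k) ^ 2)⁻¹ + N + (M + N * (b ^ k) ^ 2) + 1, by positivity,
    fun r hr _ => ?_, fun r hr => ?_⟩
  · calc ‖ψ r‖ ≤ (M * ((a ^ k) ^ 2)⁻¹ + N) * r ^ k := by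
          linarith [hψle r hr, hSzero r hr, hTzero r hr]
      _ ≤ _ := mul_le_mul_of_nonneg_right (by linarith) (by positivity)
  · have hr0 : 0 < r := one_pos.trans_le hr
    rw [Real.rpow_neg hr0.le, Real.rpow_natCast]
    calc ‖ψ r‖ ≤ (M + N * (b ^ k) ^ 2) * (r ^ k)⁻¹ := by
          linarith [hψle r hr0, hSinf r hr0, hTinf r hr0]
      _ ≤ _ := mul_le_mul_of_nonneg_right (by linarith) (by positivity)
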